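/- arXiv:2206.01152 — 2 statements merged into one kernel-verified Lean document; each statement's English description precedes it below -/
import Mathlib

section
/- Two directed acyclic graphs G and G' on the vertex set Fin p are Markov equivalent (i.e., I(G) = I(G')) if and only if they have the same skeleton and the same v-structures. -/
namespace CausalDiscovery

variable {V : Type*}

/-- A relation is acyclic if it has no directed cycles. -/
def Acyclic (E : V → V → Prop) : Prop :=
  ∀ v, ¬ Relation.TransGen E v v

/-- `i` and `j` are adjacent (joined by an edge in either direction). -/
def Adj (E : V → V → Prop) (i j : V) : Prop :=
  E i j ∨ E j i

/-- `j` is a descendant of `i`, i.e. reachable from `i` by a directed path. -/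
def Desc (E : V → V → Prop) (i j : V) : Prop :=
  Relation.ReflTransGen E i j

/-- `f 0, f 1, …, f n` is a path between `i` and `j`: the vertices are distinct and
consecutive vertices are adjacent. -/
def IsPath (E : V → V → Prop) (n : ℕ) (f : ℕ → V) (i j : V) : Prop :=
  0 < n ∧ f 0 = i ∧ f n = j ∧
    (∀ s t, s ≤ n → t ≤ n → f s = f t → s = t) ∧
    ∀ t, t < n → Adj E (f t) (f (t + 1))

/-- The vertex at (interior) position `t` of the path `f` is a collider:
both edges of the path at that vertex point into it. -/
def ColliderAt (E : V → V → Prop) (f : ℕ → V) (t : ℕ) : Prop :=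
  E (f (t - 1)) (f t) ∧ E (f (t + 1)) (f t)

/-- The path `f 0, …, f n` d-connects its endpoints given `C`: every non-collider
interior vertex is outside `C`, every collider is in `C` or has a descendant in `C`. -/
def DConn (E : V → V → Prop) (n : ℕ) (f : ℕ → V) (C : Finset V) : Prop :=
  ∀ t, 0 < t → t < n →
    (ColliderAt E f t → f t ∈ C ∨ ∃ d ∈ C, Desc E (f t) d) ∧
    (¬ ColliderAt E f t → f t ∉ C)

/-- `i` and `j` are d-separated given `C`: no path between them d-connects given `C`. -/
def DSep (E : V → V → Prop) (i j : V) (C : Finset V) : Prop :=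
  ∀ n f, IsPath E n f i j → ¬ DConn E n f C

/-- The independence model `I(E)`: all d-separation triples `(i, j, C)` with `i, j`
distinct and `C ⊆ V \ {i, j}`. -/
def Indep (E : V → V → Prop) : Set (V × V × Finset V) :=
  {x | x.1 ≠ x.2.1 ∧ x.1 ∉ x.2.2 ∧ x.2.1 ∉ x.2.2 ∧ DSep E x.1 x.2.1 x.2.2}

/-- Two graphs are Markov equivalent if they have the same independence model. -/
def MarkovEquiv (E E' : V → V → Prop) : Prop :=
  Indep E = Indep E'

/-- Two graphs have the same skeleton if they have the same adjacencies. -/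
def SameSkeleton (E E' : V → V → Prop) : Prop :=
  ∀ i j, Adj E i j ↔ Adj E' i j

/-- The v-structures of a graph: triples `(i, j, k)` with `i → j ← k` and `i, k`
not adjacent. -/
def VStruct (E : V → V → Prop) : Set (V × V × V) :=
  {x | E x.1 x.2.1 ∧ E x.2.2 x.2.1 ∧ x.1 ≠ x.2.2 ∧ ¬ Adj E x.1 x.2.2}

/-! ### Basic facts about acyclic relations -/

theorem Acyclic.asymm {E : V → V → Prop} (hE : Acyclic E) {a b : V} (h : E a b) : ¬ E b a :=
  fun h' => hE a (.tail (.single h) h')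

theorem Acyclic.irrefl {E : V → V → Prop} (hE : Acyclic E) (a : V) : ¬ E a a :=
  fun h => hE a (.single h)

theorem Adj.symm {E : V → V → Prop} {a b : V} (h : Adj E a b) : Adj E b a := Or.symm h

theorem Acyclic.wellFounded [Finite V] {E : V → V → Prop} (hE : Acyclic E) :
    WellFounded (Relation.TransGen E) :=
  @Finite.wellFounded_of_trans_of_irrefl V _ _ ⟨fun _ _ _ => Relation.TransGen.trans⟩ ⟨hE⟩

theorem Acyclic.wellFounded_swap [Finite V] {E : V → V → Prop} (hE : Acyclic E) :
    WellFounded (Function.swap (Relation.TransGen E)) :=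
  @Finite.wellFounded_of_trans_of_irrefl V _ _ ⟨fun _ _ _ h h' => h'.trans h⟩ ⟨hE⟩

/-- The ancestors of a finite set of vertices. -/
def AncOf (E : V → V → Prop) (C : Finset V) (v : V) : Prop := ∃ d ∈ C, Desc E v d

theorem AncOf.of_mem {E : V → V → Prop} {C : Finset V} {v : V} (h : v ∈ C) : AncOf E C v :=
  ⟨v, h, .refl⟩

theorem AncOf.head {E : V → V → Prop} {C : Finset V} {v w : V} (h : E v w)
    (hw : AncOf E C w) : AncOf E C v := by
  obtain ⟨d, hd, hwd⟩ := hw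
  exact ⟨d, hd, .head h hwd⟩

theorem DConn.ancOf {E : V → V → Prop} {n : ℕ} {f : ℕ → V} {C : Finset V} (h : DConn E n f C)
    {t : ℕ} (h0 : 0 < t) (hn : t < n) (hc : ColliderAt E f t) : AncOf E C (f t) :=
  ((h t h0 hn).1 hc).elim AncOf.of_mem id

/-! ### From walks to paths -/

/-- `f 0, …, f n` is a walk from `i` to `j`, possibly with repeated vertices. -/
def IsWalk (E : V → V → Prop) (n : ℕ) (f : ℕ → V) (i j : V) : Prop :=
  f 0 = i ∧ f n = j ∧ ∀ t, t < n → Adj E (f t) (f (t + 1))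

theorem DConn.ancOf_or_transGen {E : V → V → Prop} {n : ℕ} {f : ℕ → V}
    {C : Finset V} (hadj : ∀ t, t < n → Adj E (f t) (f (t + 1))) (h : DConn E n f C) {s : ℕ}
    (hs : E (f s) (f (s + 1))) (m : ℕ) (hm : s + m + 1 ≤ n) :
    AncOf E C (f s) ∨
      (E (f (s + m)) (f (s + m + 1)) ∧ Relation.TransGen E (f s) (f (s + m + 1))) := by
  induction m with
  | zero => exact .inr ⟨hs, .single hs⟩
  | succ m ih =>
    rcases ih (by omega) with ih | ⟨h1, h2⟩
    · exact .inl ih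
    · rcases hadj (s + m + 1) (by omega) with h3 | h3
      · exact .inr ⟨h3, h2.tail h3⟩
      · obtain ⟨d, hd, hd'⟩ := h.ancOf (t := s + m + 1) (by omega) (by omega) ⟨h1, h3⟩
        exact .inl ⟨d, hd, h2.to_reflTransGen.trans hd'⟩

/-- A d-connecting walk visiting a vertex twice can be shortened. -/
theorem IsWalk.exists_shorter {E : V → V → Prop} (hE : Acyclic E) {n : ℕ} {f : ℕ → V}
    {i j : V} {C : Finset V} (hw : IsWalk E n f i j) (hc : DConn E n f C) {s t : ℕ}
    (hst : s < t) (htn : t ≤ n) (heq : f s = f t) :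
    ∃ m < n, ∃ g, IsWalk E m g i j ∧ DConn E m g C := by
  obtain ⟨h0, hn, hadj⟩ := hw
  obtain ⟨δ, rfl⟩ := Nat.exists_eq_add_of_lt hst
  obtain ⟨r, rfl⟩ := Nat.exists_eq_add_of_le htn
  let g : ℕ → V := fun k => if k ≤ s then f k else f (k + (δ + 1))
  have g1 : ∀ k, k ≤ s → g k = f k := fun k hk => by simp [g, hk]
  have g2 : ∀ k, s ≤ k → g k = f (k + (δ + 1)) := by
    intro k hk
    rcases hk.eq_or_lt with rfl | hk
    · simp only [g, le_refl, if_true]; rw [heq]; congr 1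
    · simp [g, not_le.mpr hk]
  refine ⟨s + r, by omega, g, ⟨by rw [g1 0 (by omega), h0], ?_, ?_⟩, ?_⟩
  · rw [g2 _ (by omega), ← hn]; congr 1; omega
  · intro k hk
    rcases lt_or_ge k s with hks | hks
    · rw [g1 k hks.le, g1 (k + 1) hks]; exact hadj k (by omega)
    · rw [g2 k hks, g2 (k + 1) (by omega), show k + 1 + (δ + 1) = k + (δ + 1) + 1 by omega]
      exact hadj _ (by omega)
  · intro k hk0 hk
    rcases lt_trichotomy k s with hks | rfl | hks
    · have := hc k hk0 (by omega)
      simpa only [ColliderAt, g1 k hks.le, g1 (k + 1) hks, g1 (k - 1) (by omega)] using this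
    · have e1 : g (k + 1) = f (k + δ + 1 + 1) := by
        rw [g2 _ (by omega)]; congr 1; omega
      simp only [ColliderAt, g1 k le_rfl, e1, g1 (k - 1) (by omega)]
      refine ⟨?_, ?_⟩
      · rintro ⟨ha, -⟩
        right
        rcases hadj k (by omega) with h3 | h3
        · rcases hc.ancOf_or_transGen hadj h3 δ (by omega) with h4 | ⟨-, h4⟩
          · exact h4
          · rw [← heq] at h4
            exact absurd h4 (hE _)
        · exact hc.ancOf hk0 (by omega) ⟨ha, h3⟩
      · intro hnc
        by_cases ha : E (f (k - 1)) (f k)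
        · rw [heq]
          refine (hc (k + δ + 1) (by omega) (by omega)).2 fun h => hnc ⟨ha, ?_⟩
          rw [heq]; exact h.2
        · exact (hc k hk0 (by omega)).2 fun h => ha h.1
    · have := hc (k + (δ + 1)) (by omega) (by omega)
      simpa only [ColliderAt, g2 k hks.le, g2 (k + 1) (by omega), g2 (k - 1) (by omega),
        show k - 1 + (δ + 1) = k + (δ + 1) - 1 by omega,
        show k + 1 + (δ + 1) = k + (δ + 1) + 1 by omega] using this

theorem IsWalk.not_dSep {E : V → V → Prop} (hE : Acyclic E) {n : ℕ} {f : ℕ → V} {i j : V}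
    {C : Finset V} (hij : i ≠ j) (hw : IsWalk E n f i j) (hc : DConn E n f C) :
    ¬ DSep E i j C := by
  induction n using Nat.strong_induction_on generalizing f with
  | _ n ih =>
    by_cases hinj : ∀ s t, s ≤ n → t ≤ n → f s = f t → s = t
    · refine fun h => h n f ⟨?_, hw.1, hw.2.1, hinj, hw.2.2⟩ hc
      rcases Nat.eq_zero_or_pos n with rfl | h
      · exact absurd (hw.1.symm.trans hw.2.1) hij
      · exact h
    · push Not at hinj
      obtain ⟨s, t, hs, ht, heq, hne⟩ := hinj
      rcases lt_or_gt_of_ne hne with h | h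
      · obtain ⟨m, hm, g, hg, hgc⟩ := hw.exists_shorter hE hc h ht heq
        exact ih m hm hg hgc
      · obtain ⟨m, hm, g, hg, hgc⟩ := hw.exists_shorter hE hc h hs heq.symm
        exact ih m hm hg hgc

/-! ### Reachability along d-connecting walks -/

/-- `Reach E C i v b`: there is a d-connecting walk from `i` to `v` whose last edge points
into `v` if `b = true` and out of `v` if `b = false` (the trivial walk counts as the latter). -/
inductive Reach (E : V → V → Prop) (C : Finset V) (i : V) : V → Bool → Prop
  | start : Reach E C i i false
  | up {v w : V} : Reach E C i v false → v ∉ C → E w v → Reach E C i w false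
  | down {v w : V} {b : Bool} : Reach E C i v b → v ∉ C → E v w → Reach E C i w true
  | collider {v w : V} : Reach E C i v true → AncOf E C v → E w v → Reach E C i w false

theorem exists_walk_extend {E : V → V → Prop} {C : Finset V} {n : ℕ} {f : ℕ → V} {i v w : V}
    (hw : IsWalk E n f i v) (hc : DConn E n f C) (hvw : Adj E v w)
    (hv : 0 < n → ((E (f (n - 1)) v ∧ E w v) → AncOf E C v) ∧
      (¬ (E (f (n - 1)) v ∧ E w v) → v ∉ C)) :
    ∃ g, IsWalk E (n + 1) g i w ∧ DConn E (n + 1) g C ∧ g n = v := by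
  obtain ⟨h0, hn, hadj⟩ := hw
  let g : ℕ → V := fun k => if k ≤ n then f k else w
  have g1 : ∀ k, k ≤ n → g k = f k := fun k hk => by simp [g, hk]
  have g2 : g (n + 1) = w := by simp [g]
  refine ⟨g, ⟨by rw [g1 0 (by omega), h0], g2, fun t ht => ?_⟩, fun t ht0 ht => ?_,
    by rw [g1 n le_rfl, hn]⟩
  · rcases (Nat.lt_succ_iff.mp ht).eq_or_lt with rfl | ht'
    · rw [g1 t le_rfl, g2, hn]; exact hvw
    · rw [g1 t ht'.le, g1 (t + 1) ht']; exact hadj t ht'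
  · rcases (Nat.lt_succ_iff.mp ht).eq_or_lt with rfl | ht'
    · simp only [ColliderAt, g1 t le_rfl, g2, hn, g1 (t - 1) (by omega)]
      exact ⟨fun h => .inr ((hv ht0).1 h), (hv ht0).2⟩
    · have := hc t ht0 ht'
      simpa only [ColliderAt, g1 t ht'.le, g1 (t + 1) ht', g1 (t - 1) (by omega)] using this

theorem Reach.exists_walk {E : V → V → Prop} (hE : Acyclic E) {C : Finset V} {i v : V} {b : Bool}
    (h : Reach E C i v b) :
    ∃ n f, IsWalk E n f i v ∧ DConn E n f C ∧
      (b = false → 0 < n → ¬ E (f (n - 1)) v) ∧ (b = true → E (f (n - 1)) v) := by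
  induction h with
  | start =>
    exact ⟨0, fun _ => i, ⟨rfl, rfl, fun t ht => absurd ht (by omega)⟩,
      fun t h0 ht => absurd ht (by omega), fun _ h => absurd h (by omega), by simp⟩
  | up _ hv hwv ih =>
    obtain ⟨n, f, hw, hc, hb, -⟩ := ih
    obtain ⟨g, hg, hgc, hgn⟩ := exists_walk_extend hw hc (.inr hwv)
      fun h0 => ⟨fun h => absurd h.1 (hb rfl h0), fun _ => hv⟩
    exact ⟨n + 1, g, hg, hgc, fun _ _ => by simpa [hgn] using hE.asymm hwv, by simp⟩
  | down _ hv hvw ih =>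
    obtain ⟨n, f, hw, hc, -, -⟩ := ih
    obtain ⟨g, hg, hgc, hgn⟩ := exists_walk_extend hw hc (.inl hvw)
      fun h0 => ⟨fun h => absurd h.2 (hE.asymm hvw), fun _ => hv⟩
    exact ⟨n + 1, g, hg, hgc, by simp, fun _ => by simpa [hgn] using hvw⟩
  | collider _ hv hwv ih =>
    obtain ⟨n, f, hw, hc, -, hb⟩ := ih
    obtain ⟨g, hg, hgc, hgn⟩ := exists_walk_extend hw hc (.inr hwv)
      fun h0 => ⟨fun _ => hv, fun h => absurd ⟨hb rfl, hwv⟩ h⟩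
    exact ⟨n + 1, g, hg, hgc, fun _ _ => by simpa [hgn] using hE.asymm hwv, by simp⟩

theorem Reach.not_dSep {E : V → V → Prop} (hE : Acyclic E) {C : Finset V} {i j : V} {b : Bool}
    (hij : i ≠ j) (h : Reach E C i j b) : ¬ DSep E i j C := by
  obtain ⟨n, f, hw, hc, -⟩ := h.exists_walk hE
  exact hw.not_dSep hE hij hc

theorem Reach.of_desc_start {E : V → V → Prop} {C : Finset V} {i v : V}
    (h : Desc E v i) (hv : ¬ AncOf E C v) : Reach E C i v false := by
  induction h using Relation.ReflTransGen.head_induction_on with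
  | refl => exact .start
  | head hac _ ih =>
    have hc := fun h => hv (.head hac h)
    exact .up (ih hc) (fun h => hc (.of_mem h)) hac

theorem Reach.desc {E : V → V → Prop} {C : Finset V} {i j v : V} {b : Bool}
    (hr : Reach E C i v b) (h : Desc E v j) (hv : ¬ AncOf E C v) : ∃ b, Reach E C i j b := by
  induction h using Relation.ReflTransGen.head_induction_on generalizing b with
  | refl => exact ⟨b, hr⟩
  | head hac _ ih => exact ih (.down hr (fun h => hv (.of_mem h)) hac) fun h => hv (.head hac h)

/-! ### The moral ancestral graph -/

/-- The ancestral set of `{i, j} ∪ C`. -/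
def Ancestral (E : V → V → Prop) (i j : V) (C : Finset V) (v : V) : Prop :=
  ∃ d, (d = i ∨ d = j ∨ d ∈ C) ∧ Desc E v d

theorem Ancestral.head {E : V → V → Prop} {i j : V} {C : Finset V} {v w : V} (h : E v w)
    (hw : Ancestral E i j C w) : Ancestral E i j C v := by
  obtain ⟨d, hd, hwd⟩ := hw
  exact ⟨d, hd, .head h hwd⟩

theorem AncOf.ancestral {E : V → V → Prop} {i j : V} {C : Finset V} {v : V}
    (h : AncOf E C v) : Ancestral E i j C v := by
  obtain ⟨d, hd, hvd⟩ := h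
  exact ⟨d, .inr (.inr hd), hvd⟩

/-- `a` belongs to the family of `v`, consisting of `v` and its parents. -/
def Fam (E : V → V → Prop) (v a : V) : Prop := a = v ∨ E a v

/-- A step outside `C` in the moral graph of the ancestral set of `{i, j} ∪ C`. -/
def MoralStep (E : V → V → Prop) (i j : V) (C : Finset V) (a b : V) : Prop :=
  b ∉ C ∧ ∃ v, Ancestral E i j C v ∧ Fam E v a ∧ Fam E v b

/-- `i` and `b` are connected outside `C` in the moral graph of the ancestral set
of `{i, j} ∪ C`. -/
def MoralConn (E : V → V → Prop) (i j : V) (C : Finset V) (b : V) : Prop :=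
  Relation.ReflTransGen (MoralStep E i j C) i b

theorem Fam.ancestral {E : V → V → Prop} {i j : V} {C : Finset V} {v a : V}
    (h : Fam E v a) (hv : Ancestral E i j C v) : Ancestral E i j C a := by
  rcases h with rfl | h
  · exact hv
  · exact .head h hv

theorem MoralConn.ancestral {E : V → V → Prop} {i j : V} {C : Finset V} {b : V}
    (h : MoralConn E i j C b) : Ancestral E i j C b := by
  rcases Relation.ReflTransGen.cases_tail h with rfl | ⟨a, -, -, v, hv, -, hb⟩
  · exact ⟨_, .inl rfl, .refl⟩
  · exact hb.ancestral hv

theorem MoralConn.not_mem {E : V → V → Prop} {i j : V} {C : Finset V} (hi : i ∉ C) {b : V}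
    (h : MoralConn E i j C b) : b ∉ C := by
  rcases Relation.ReflTransGen.cases_tail h with rfl | ⟨a, -, hb, -⟩
  · exact hi
  · exact hb

theorem Reach.collider_or {E : V → V → Prop} {C : Finset V} {i j v w : V}
    (hr : Reach E C i v true) (hv : Ancestral E i j C v) (hwv : E w v) :
    Reach E C i w false ∨ ∃ b, Reach E C i j b := by
  by_cases hC : AncOf E C v
  · exact .inl (.collider hr hC hwv)
  obtain ⟨d, rfl | rfl | hd, hvd⟩ := hv
  · exact .inl (.up (.of_desc_start hvd hC) (fun h => hC (.of_mem h)) hwv)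
  · exact .inr (hr.desc hvd hC)
  · exact absurd ⟨d, hd, hvd⟩ hC

theorem MoralConn.reach {E : V → V → Prop} {C : Finset V} {i j : V} (hi : i ∉ C) {a : V}
    (h : MoralConn E i j C a) : (∃ b, Reach E C i a b) ∨ ∃ b, Reach E C i j b := by
  induction h with
  | refl => exact .inl ⟨_, .start⟩
  | @tail a c hia hac ih =>
    rcases ih with ⟨b, hb⟩ | ih
    swap
    · exact .inr ih
    have haC : a ∉ C := MoralConn.not_mem hi hia
    obtain ⟨-, v, hv, hav | hav, hcv | hcv⟩ := hac
    · subst hav hcv; exact .inl ⟨b, hb⟩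
    · subst hav
      cases b with
      | false => exact .inl ⟨_, .up hb haC hcv⟩
      | true => exact (hb.collider_or hv hcv).imp_left fun h => ⟨_, h⟩
    · subst hcv; exact .inl ⟨_, .down hb haC hav⟩
    · exact (Reach.collider_or (.down hb haC hav) hv hcv).imp_left fun h => ⟨_, h⟩

theorem MoralConn.not_dSep {E : V → V → Prop} (hE : Acyclic E) {C : Finset V} {i j : V}
    (hij : i ≠ j) (hi : i ∉ C) (h : MoralConn E i j C j) : ¬ DSep E i j C := by
  obtain ⟨b, hb⟩ : ∃ b, Reach E C i j b := by simpa using h.reach hi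
  exact hb.not_dSep hE hij

theorem DConn.ancestral {E : V → V → Prop} {n : ℕ} {f : ℕ → V} {i j : V}
    {C : Finset V} (hw : IsWalk E n f i j) (hc : DConn E n f C) {t : ℕ} (ht : t ≤ n) :
    Ancestral E i j C (f t) := by
  obtain ⟨h0, hn, hadj⟩ := hw
  have hi : Ancestral E i j C (f 0) := ⟨i, .inl rfl, h0 ▸ .refl⟩
  have hj : Ancestral E i j C (f n) := ⟨j, .inr (.inl rfl), hn ▸ .refl⟩
  have back : ∀ t, t < n → E (f (t + 1)) (f t) → Ancestral E i j C (f t) := by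
    intro t
    induction t with
    | zero => exact fun _ _ => hi
    | succ t ih =>
      intro ht h
      rcases hadj t (by omega) with h' | h'
      · exact (hc.ancOf (Nat.succ_pos t) ht ⟨h', h⟩).ancestral
      · exact .head h' (ih (by omega) h')
  have forw : ∀ m t, t + 1 + m = n → E (f t) (f (t + 1)) → Ancestral E i j C (f (t + 1)) := by
    intro m
    induction m with
    | zero => rintro t rfl _; exact hj
    | succ m ih =>
      intro t ht h
      rcases hadj (t + 1) (by omega) with h' | h'
      · exact .head h' (ih (t + 1) (by omega) h')
      · exact (hc.ancOf (Nat.succ_pos t) (by omega) ⟨h, h'⟩).ancestral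
  rcases ht.eq_or_lt with rfl | ht
  · exact hj
  rcases hadj t ht with h | h
  · exact .head h (forw (n - (t + 1)) t (by omega) h)
  · exact back t ht h

theorem DConn.moralConn {E : V → V → Prop} (hE : Acyclic E) {n : ℕ} {f : ℕ → V} {i j : V}
    {C : Finset V} (hj : j ∉ C) (hw : IsWalk E n f i j) (hc : DConn E n f C) :
    MoralConn E i j C j := by
  have hS := fun t (ht : t ≤ n) => hc.ancestral hw ht
  obtain ⟨h0, hn, hadj⟩ := hw
  have notMem : ∀ t, t < n → E (f (t + 1)) (f t) → f (t + 1) ∉ C := by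
    intro t ht h
    rcases (Nat.succ_le_of_lt ht).eq_or_lt with h' | h'
    · rw [← Nat.succ_eq_add_one, h', hn]; exact hj
    · exact (hc (t + 1) (Nat.succ_pos t) h').2 fun hcol => hE.asymm h hcol.1
  have key : ∀ t, t ≤ n → MoralConn E i j C (f t) ∨
      (0 < t ∧ E (f (t - 1)) (f t) ∧ MoralConn E i j C (f (t - 1))) := by
    intro t
    induction t with
    | zero => intro _; rw [h0]; exact .inl .refl
    | succ t ih =>
      intro ht
      have step : MoralConn E i j C (f t) → MoralConn E i j C (f (t + 1)) ∨
          (0 < t + 1 ∧ E (f t) (f (t + 1)) ∧ MoralConn E i j C (f t)) := by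
        intro h
        rcases hadj t ht with h' | h'
        · exact .inr ⟨Nat.succ_pos t, h', h⟩
        · exact .inl (.tail h ⟨notMem t ht h', f t, hS t (by omega), .inl rfl, .inr h'⟩)
      rcases ih (by omega) with h | ⟨ht0, h1, h2⟩
      · exact step h
      · by_cases hcol : E (f (t + 1)) (f t)
        · exact .inl (.tail h2 ⟨notMem t ht hcol, f t, hS t (by omega), .inr h1, .inr hcol⟩)
        · exact step (.tail h2 ⟨(hc t ht0 (by omega)).2 fun h => hcol h.2, f t, hS t (by omega),
            .inr h1, .inl rfl⟩)
  rcases key n le_rfl with h | ⟨-, h1, h2⟩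
  · rwa [hn] at h
  · rw [hn] at h1
    exact .tail h2 ⟨hj, j, ⟨j, .inr (.inl rfl), .refl⟩, .inr h1, .inl rfl⟩

/-- The moralization criterion for d-separation. -/
theorem not_dSep_iff_moralConn {E : V → V → Prop} (hE : Acyclic E) {C : Finset V} {i j : V}
    (hij : i ≠ j) (hi : i ∉ C) (hj : j ∉ C) : ¬ DSep E i j C ↔ MoralConn E i j C j := by
  refine ⟨fun h => ?_, fun h => h.not_dSep hE hij hi⟩
  simp only [DSep, not_forall, not_not] at h
  obtain ⟨n, f, ⟨-, h0, hn, -, hadj⟩, hc⟩ := h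
  exact hc.moralConn hE hj ⟨h0, hn, hadj⟩

/-! ### Reversal of covered edges -/

/-- The edge `x → y` is covered: `x` and `y` have the same parents, apart from `x` itself. -/
def Covered (E : V → V → Prop) (x y : V) : Prop :=
  E x y ∧ ∀ z, z ≠ x → (E z y ↔ E z x)

/-- The graph obtained by replacing the edge `x → y` by `y → x`. -/
def Flip (E : V → V → Prop) (x y : V) (a b : V) : Prop :=
  (E a b ∧ ¬ (a = x ∧ b = y)) ∨ (a = y ∧ b = x)

theorem Covered.flip_acyclic {E : V → V → Prop} (hE : Acyclic E) {x y : V}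
    (h : Covered E x y) : Acyclic (Flip E x y) := by
  let R : V → V → Prop := fun a b => E a b ∧ ¬ (a = x ∧ b = y)
  have key : ∀ a b, Relation.TransGen (Flip E x y) a b → Relation.TransGen R a b ∨
      (Relation.ReflTransGen R a y ∧ Relation.ReflTransGen R x b) := by
    intro a b hab
    induction hab with
    | single hab =>
      rcases hab with hab | ⟨rfl, rfl⟩
      · exact .inl (.single hab)
      · exact .inr ⟨.refl, .refl⟩
    | tail _ hbc ih =>
      rcases hbc with hbc | ⟨rfl, rfl⟩
      · exact ih.imp (fun h => h.tail hbc) fun h => ⟨h.1, h.2.tail hbc⟩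
      · exact .inr ⟨ih.elim (fun h => h.to_reflTransGen) fun h => h.1, .refl⟩
  have hRE : ∀ a b, R a b → E a b := fun _ _ h => h.1
  intro v hv
  rcases key v v hv with hv | ⟨hvy, hxv⟩
  · exact hE v (Relation.TransGen.mono hRE _ _ hv)
  · rcases Relation.ReflTransGen.cases_tail (hxv.trans hvy) with rfl | ⟨z, hxz, hzy, hz⟩
    · exact hE.irrefl _ h.1
    · have hzx : z ≠ x := fun h => hz ⟨h, rfl⟩
      exact hE x (.tail' (Relation.ReflTransGen.mono hRE _ _ hxz) ((h.2 z hzx).1 hzy))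

theorem flip_flip {E : V → V → Prop} (hE : Acyclic E) {x y : V} (h : E x y) :
    Flip (Flip E x y) y x = E := by
  have hyx := hE.asymm h
  funext a b
  simp only [Flip, eq_iff_iff]
  constructor
  · rintro (⟨⟨h1, -⟩ | h1, h2⟩ | ⟨rfl, rfl⟩)
    · exact h1
    · exact absurd h1 h2
    · exact h
  · intro hab
    by_cases hc : a = x ∧ b = y
    · exact .inr hc
    · refine .inl ⟨.inl ⟨hab, hc⟩, ?_⟩
      rintro ⟨rfl, rfl⟩
      exact hyx hab

theorem Covered.flip {E : V → V → Prop} (hE : Acyclic E) {x y : V} (h : Covered E x y) :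
    Covered (Flip E x y) y x := by
  have hne : x ≠ y := by rintro rfl; exact hE.irrefl _ h.1
  refine ⟨.inr ⟨rfl, rfl⟩, fun z hz => ?_⟩
  by_cases hzx : z = x
  · subst hzx
    simp [Flip, hne, hE.irrefl]
  · simp [Flip, hz, hzx, hne, h.2 z hzx]

theorem Covered.ancestral_flip {E : V → V → Prop} {x y : V} (h : Covered E x y)
    {i j v : V} {C : Finset V} (hv : Ancestral E i j C v) :
    Ancestral (Flip E x y) i j C v ∨ (v = x ∧ Ancestral (Flip E x y) i j C y) := by
  obtain ⟨d, hd, hvd⟩ := hv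
  induction hvd using Relation.ReflTransGen.head_induction_on with
  | refl => exact .inl ⟨d, hd, .refl⟩
  | @head a c hac _ ih =>
    rcases ih with ih | ⟨rfl, ih⟩
    · by_cases hxy : a = x ∧ c = y
      · obtain ⟨rfl, rfl⟩ := hxy
        exact .inr ⟨rfl, ih⟩
      · exact .inl (.head (.inl ⟨hac, hxy⟩) ih)
    · by_cases hax : a = c
      · exact .inr ⟨hax, ih⟩
      · exact .inl (.head (.inl ⟨(h.2 a hax).2 hac, fun h => hax h.1⟩) ih)

theorem Covered.moralConn_flip {E : V → V → Prop} (hE : Acyclic E) {x y : V}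
    (h : Covered E x y) {i j a : V} {C : Finset V} (hc : MoralConn E i j C a) :
    MoralConn (Flip E x y) i j C a ∨ (a = x ∧ ¬ Ancestral (Flip E x y) i j C x ∧
      ∃ u, MoralConn (Flip E x y) i j C u ∧ Fam (Flip E x y) y u) := by
  have hne : x ≠ y := by rintro rfl; exact hE.irrefl _ h.1
  have fam_ne : ∀ v c, v ≠ x → v ≠ y → Fam E v c → Fam (Flip E x y) v c := by
    rintro v c hx hy (rfl | hcv)
    · exact .inl rfl
    · exact .inr (.inl ⟨hcv, fun h => hy h.2⟩)
  have fam_y : ∀ v c, v = x ∨ v = y → c ≠ x → Fam E v c → Fam (Flip E x y) y c := by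
    rintro v c (rfl | rfl) hcx (rfl | hcv)
    · exact absurd rfl hcx
    · exact .inr (.inl ⟨(h.2 c hcx).2 hcv, fun h => hcx h.1⟩)
    · exact .inl rfl
    · exact .inr (.inl ⟨hcv, fun h => hcx h.1⟩)
  have fam_x : ∀ v c, v = x ∨ v = y → Fam E v c → Fam (Flip E x y) x c := by
    intro v c hv hc
    by_cases hcx : c = x
    · exact .inl hcx
    by_cases hcy : c = y
    · exact .inr (.inr ⟨hcy, rfl⟩)
    rcases fam_y v c hv hcx hc with rfl | hf
    · exact absurd rfl hcy
    · have hcE : E c y := by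
        rcases hf with hf | hf
        · exact hf.1
        · exact absurd hf.1 hcy
      exact .inr (.inl ⟨(h.2 c hcx).1 hcE, fun h => hcx h.1⟩)
  induction hc with
  | refl => exact .inl .refl
  | @tail a b _ hab ih =>
    obtain ⟨hbC, v, hv, ha, hb⟩ := hab
    have hv' := h.ancestral_flip hv
    have anc_y : v = x ∨ v = y → Ancestral (Flip E x y) i j C y := by
      rintro (rfl | rfl)
      · rcases hv' with hv' | hv'
        · exact .head (.inr ⟨rfl, rfl⟩) hv'
        · exact hv'.2
      · rcases hv' with hv' | hv'
        · exact hv'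
        · exact hv'.2
    by_cases hxS : Ancestral (Flip E x y) i j C x
    · rcases ih with ih | ⟨-, ih, -⟩
      swap
      · exact absurd hxS ih
      by_cases hvxy : v = x ∨ v = y
      · exact .inl (.tail ih ⟨hbC, x, hxS, fam_x v a hvxy ha, fam_x v b hvxy hb⟩)
      · push Not at hvxy
        refine .inl (.tail ih ⟨hbC, v, ?_, fam_ne v a hvxy.1 hvxy.2 ha,
          fam_ne v b hvxy.1 hvxy.2 hb⟩)
        exact hv'.resolve_right fun h => hvxy.1 h.1
    · by_cases hvxy : v = x ∨ v = y
      · have hyS := anc_y hvxy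
        obtain ⟨u, hu, huy⟩ :
            ∃ u, MoralConn (Flip E x y) i j C u ∧ Fam (Flip E x y) y u := by
          rcases ih with ih | ⟨-, -, ih⟩
          · exact ⟨a, ih, fam_y v a hvxy (fun h => hxS (h ▸ ih.ancestral)) ha⟩
          · exact ih
        by_cases hbx : b = x
        · exact .inr ⟨hbx, hxS, u, hu, huy⟩
        · exact .inl (.tail hu ⟨hbC, y, hyS, huy, fam_y v b hvxy hbx hb⟩)
      · push Not at hvxy
        have hvS := hv'.resolve_right fun h => hvxy.1 h.1
        have hav := fam_ne v a hvxy.1 hvxy.2 ha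
        rcases ih with ih | ⟨rfl, -, -⟩
        · exact .inl (.tail ih ⟨hbC, v, hvS, hav, fam_ne v b hvxy.1 hvxy.2 hb⟩)
        · exact absurd (hav.ancestral hvS) hxS

theorem Covered.not_dSep_flip {E : V → V → Prop} (hE : Acyclic E) {x y : V}
    (h : Covered E x y) {i j : V} {C : Finset V} (hij : i ≠ j) (hi : i ∉ C) (hj : j ∉ C)
    (hd : ¬ DSep E i j C) : ¬ DSep (Flip E x y) i j C := by
  rw [not_dSep_iff_moralConn hE hij hi hj] at hd
  rw [not_dSep_iff_moralConn (h.flip_acyclic hE) hij hi hj]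
  rcases h.moralConn_flip hE hd with h | ⟨rfl, h, -⟩
  · exact h
  · exact absurd ⟨j, .inr (.inl rfl), .refl⟩ h

theorem Covered.markovEquiv_flip {E : V → V → Prop} (hE : Acyclic E) {x y : V}
    (h : Covered E x y) : MarkovEquiv E (Flip E x y) := by
  ext ⟨i, j, C⟩
  simp only [Indep, Set.mem_ofPred_eq]
  refine and_congr_right fun hij => and_congr_right fun hi => and_congr_right fun hj =>
    not_iff_not.mp ⟨h.not_dSep_flip hE hij hi hj, fun hd => ?_⟩
  have := (h.flip hE).not_dSep_flip (h.flip_acyclic hE) hij hi hj hd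
  rwa [flip_flip hE h.1] at this

/-! ### Markov equivalence determines the skeleton and the v-structures -/

theorem not_dSep_of_adj {E : V → V → Prop} {i j : V} {C : Finset V} (hij : i ≠ j)
    (h : Adj E i j) : ¬ DSep E i j C := by
  refine fun hs => hs 1 (fun t => if t = 0 then i else j) ⟨one_pos, rfl, rfl, ?_, ?_⟩ ?_
  · intro s t hs ht
    interval_cases s <;> interval_cases t <;> simp [hij, hij.symm]
  · intro t ht
    obtain rfl : t = 0 := by omega
    simpa using h
  · intro t h0 h1
    omega

/-- If `j` is not an ancestor of `i`, then the parents of `j` separate `i` and `j`. -/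
theorem exists_dSep_of_not_desc [Finite V] {E : V → V → Prop} (hE : Acyclic E) {i j : V}
    (h : ¬ Adj E i j) (hd : ¬ Desc E j i) :
    ∃ C : Finset V, i ∉ C ∧ j ∉ C ∧ DSep E i j C ∧ DSep E j i C := by
  let C : Finset V := (Set.toFinite {v | E v j}).toFinset
  have hC : ∀ v, v ∈ C ↔ E v j := fun v => by simp [C]
  have hi : i ∉ C := fun hi => h (.inl ((hC i).1 hi))
  have hj : j ∉ C := fun hj => hE.irrefl j ((hC j).1 hj)
  have hij : i ≠ j := by rintro rfl; exact hd .refl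
  have eq_of_fam : ∀ v a, (Ancestral E i j C v ∨ Ancestral E j i C v) → Fam E v j →
      Fam E v a → a ∉ C → a = j := by
    intro v a hv hvj hva ha
    have hv' : j = v := by
      refine hvj.resolve_right fun hjv => ?_
      obtain ⟨d, hd', hvd⟩ : ∃ d, (d = i ∨ d = j ∨ d ∈ C) ∧ Desc E v d := by
        rcases hv with hv | ⟨d, h1, h2⟩
        · exact hv
        · exact ⟨d, by tauto, h2⟩
      rcases hd' with rfl | rfl | hd'
      · exact hd (.head hjv hvd)
      · exact hE _ (.head' hjv hvd)
      · exact hE _ (.tail (.head' hjv hvd) ((hC d).1 hd'))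
    subst hv'
    exact hva.resolve_right fun h => ha ((hC a).2 h)
  refine ⟨C, hi, hj, ?_, ?_⟩
  · by_contra hs
    rw [not_dSep_iff_moralConn hE hij hi hj] at hs
    have key : ∀ b, MoralConn E i j C b → b ≠ j := by
      intro b hb
      induction hb with
      | refl => exact hij
      | tail ha hab ih =>
        rintro rfl
        obtain ⟨-, v, hv, hva, hvb⟩ := hab
        exact ih (eq_of_fam v _ (.inl hv) hvb hva (MoralConn.not_mem hi ha))
    exact key j hs rfl
  · by_contra hs
    rw [not_dSep_iff_moralConn hE hij.symm hj hi] at hs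
    have key : ∀ b, MoralConn E j i C b → b = j := by
      intro b hb
      induction hb with
      | refl => rfl
      | tail _ hab ih =>
        subst ih
        obtain ⟨hb, v, hv, hva, hvb⟩ := hab
        exact eq_of_fam v _ (.inr hv) hva hvb hb
    exact hij (key i hs)

theorem exists_dSep [Finite V] {E : V → V → Prop} (hE : Acyclic E) {i j : V} (hij : i ≠ j)
    (h : ¬ Adj E i j) : ∃ C : Finset V, i ∉ C ∧ j ∉ C ∧ DSep E i j C := by
  by_cases hd : Desc E j i
  · have hd' : ¬ Desc E i j := fun hd' => by
      rcases Relation.reflTransGen_iff_eq_or_transGen.mp hd with heq | ht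
      · exact hij heq
      · exact hE j (ht.trans_left hd')
    obtain ⟨C, h1, h2, -, h3⟩ := exists_dSep_of_not_desc hE (fun h' => h h'.symm) hd'
    exact ⟨C, h2, h1, h3⟩
  · obtain ⟨C, h1, h2, h3, -⟩ := exists_dSep_of_not_desc hE h hd
    exact ⟨C, h1, h2, h3⟩

theorem MarkovEquiv.dSep_iff {E E' : V → V → Prop} (h : MarkovEquiv E E') {i j : V}
    {C : Finset V} (hij : i ≠ j) (hi : i ∉ C) (hj : j ∉ C) : DSep E i j C ↔ DSep E' i j C := by
  have := Set.ext_iff.mp h (i, j, C)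
  simpa [Indep, hij, hi, hj] using this

theorem MarkovEquiv.adj [Finite V] {E E' : V → V → Prop} (hE : Acyclic E) (hE' : Acyclic E')
    (h : MarkovEquiv E E') {i j : V} (hadj : Adj E i j) : Adj E' i j := by
  have hij : i ≠ j := by
    rintro rfl
    exact hadj.elim (hE.irrefl _) (hE.irrefl _)
  by_contra hn
  obtain ⟨C, hi, hj, hs⟩ := exists_dSep hE' hij hn
  exact not_dSep_of_adj hij hadj ((h.dSep_iff hij hi hj).2 hs)

theorem MarkovEquiv.sameSkeleton [Finite V] {E E' : V → V → Prop} (hE : Acyclic E)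
    (hE' : Acyclic E') (h : MarkovEquiv E E') : SameSkeleton E E' :=
  fun _ _ => ⟨h.adj hE hE', MarkovEquiv.adj hE' hE (Eq.symm h)⟩

/-- A triple `i - j - k` d-connects its endpoints if `j` is a collider in `C`, or a non-collider
outside `C`. -/
theorem not_dSep_of_triple {E : V → V → Prop} (hE : Acyclic E) {i j k : V} {C : Finset V}
    (hik : i ≠ k) (hij : Adj E i j) (hjk : Adj E j k) (h : j ∈ C ↔ E i j ∧ E k j) :
    ¬ DSep E i k C := by
  refine IsWalk.not_dSep hE (n := 2)
    (f := fun t => if t = 0 then i else if t = 1 then j else k) hik ⟨rfl, rfl, ?_⟩ ?_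
  · intro t ht
    interval_cases t
    · simpa using hij
    · simpa using hjk
  · intro t h0 ht
    obtain rfl : t = 1 := by omega
    simp only [ColliderAt]
    norm_num
    exact ⟨fun h1 h2 => .inl (h.2 ⟨h1, h2⟩), fun h1 h2 => h1 (h.1 h2).1 (h.1 h2).2⟩

theorem MarkovEquiv.vStruct_subset [Finite V] {E E' : V → V → Prop} (hE : Acyclic E)
    (hE' : Acyclic E') (h : MarkovEquiv E E') : VStruct E ⊆ VStruct E' := by
  rintro ⟨i, j, k⟩ ⟨hij, hkj, hik, hadj⟩
  have hsk := h.sameSkeleton hE hE'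
  have hadj' : ¬ Adj E' i k := fun h' => hadj ((hsk i k).2 h')
  simp only at hij hkj hik
  by_contra hn
  have hn' : ¬ (E' i j ∧ E' k j) := fun h' => hn ⟨h'.1, h'.2, hik, hadj'⟩
  obtain ⟨C, hi, hk, hs⟩ := exists_dSep hE' hik hadj'
  by_cases hjC : j ∈ C
  · exact not_dSep_of_triple hE hik (.inl hij) (.inr hkj) (iff_of_true hjC ⟨hij, hkj⟩)
      ((h.dSep_iff hik hi hk).2 hs)
  · exact not_dSep_of_triple hE' hik ((hsk i j).1 (.inl hij)) ((hsk j k).1 (.inr hkj))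
      (iff_of_false hjC hn') hs

theorem MarkovEquiv.vStruct_eq [Finite V] {E E' : V → V → Prop} (hE : Acyclic E)
    (hE' : Acyclic E') (h : MarkovEquiv E E') : VStruct E = VStruct E' :=
  (h.vStruct_subset hE hE').antisymm (MarkovEquiv.vStruct_subset hE' hE (Eq.symm h))

/-! ### Transforming a graph by reversals of covered edges -/

theorem exists_covered [Finite V] {E E' : V → V → Prop} (hE : Acyclic E) (hE' : Acyclic E')
    (hsk : SameSkeleton E E') (hvs : VStruct E = VStruct E') {a b : V} (hab : E a b)
    (hba : E' b a) : ∃ x y, Covered E x y ∧ E' y x := by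
  obtain ⟨y, ⟨x₀, hx₀⟩, hymin⟩ := hE.wellFounded.has_min {y | ∃ x, E x y ∧ E' y x} ⟨b, a, hab, hba⟩
  obtain ⟨x, ⟨hxy, hyx⟩, hxmax⟩ :=
    hE.wellFounded_swap.has_min {x | E x y ∧ E' y x} ⟨x₀, hx₀⟩
  have hymin' : ∀ z w, E z w → Relation.TransGen E w y → E' z w := fun z w hzw hwy =>
    ((hsk z w).1 (.inl hzw)).resolve_right fun h => hymin w ⟨z, hzw, h⟩ hwy
  refine ⟨x, y, ⟨hxy, fun z hzx => ⟨fun hzy => ?_, fun hzx' => ?_⟩⟩, hyx⟩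
  · by_contra hn
    have hadj : Adj E x z := by
      by_contra hadj
      have : (x, y, z) ∈ VStruct E' := hvs ▸ ⟨hxy, hzy, hzx.symm, hadj⟩
      exact hE'.asymm hyx this.1
    have hxz : E x z := hadj.resolve_right hn
    have hzy' : E' z y := ((hsk z y).1 (.inl hzy)).resolve_right fun h =>
      hxmax z ⟨hzy, h⟩ (.single hxz)
    exact hE' x (.tail (.tail (.single (hymin' x z hxz (.single hzy))) hzy') hyx)
  · have hzx₁ : E' z x := hymin' z x hzx' (.single hxy)
    have hzy : z ≠ y := by
      rintro rfl
      exact hE.asymm hxy hzx'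
    have hadj : Adj E z y := by
      by_contra hadj
      have hadj' : ¬ Adj E' z y := fun h => hadj ((hsk z y).2 h)
      have : (z, x, y) ∈ VStruct E := hvs ▸ ⟨hzx₁, hyx, hzy, hadj'⟩
      exact hE.asymm hxy this.2.1
    exact hadj.resolve_right fun h => hE y (.tail (.tail (.single h) hzx') hxy)

theorem markovEquiv_of_sameSkeleton_of_vStruct_eq [Finite V] {E E' : V → V → Prop}
    (hE : Acyclic E) (hE' : Acyclic E') (hsk : SameSkeleton E E')
    (hvs : VStruct E = VStruct E') : MarkovEquiv E E' := by
  induction hn : {q : V × V | E q.1 q.2 ∧ ¬ E' q.1 q.2}.ncard using Nat.strong_induction_on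
    generalizing E with
  | _ n ih =>
    by_cases hex : ∃ a b, E a b ∧ E' b a
    · obtain ⟨a, b, hab, hba⟩ := hex
      obtain ⟨x, y, hcov, hyx⟩ := exists_covered hE hE' hsk hvs hab hba
      have hac := hcov.flip_acyclic hE
      have hm := hcov.markovEquiv_flip hE
      have hlt : {q : V × V | Flip E x y q.1 q.2 ∧ ¬ E' q.1 q.2}.ncard < n := by
        rw [← hn]
        refine Set.ncard_lt_ncard (Set.ssubset_iff_exists.2
          ⟨?_, (x, y), ⟨hcov.1, hE'.asymm hyx⟩, ?_⟩) (Set.toFinite _)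
        · rintro ⟨u, v⟩ ⟨h | ⟨h1, h2⟩, hn⟩
          · exact ⟨h.1, hn⟩
          · simp only at h1 h2 hn
            subst h1 h2
            exact absurd hyx hn
        · rintro ⟨h | ⟨h1, h2⟩, -⟩
          · exact h.2 ⟨rfl, rfl⟩
          · simp only at h1
            subst h1
            exact hE.irrefl _ hcov.1
      have hsk' : SameSkeleton (Flip E x y) E' := fun u v =>
        (hm.sameSkeleton hE hac u v).symm.trans (hsk u v)
      exact Eq.trans hm (ih _ hlt hac hsk' ((hm.vStruct_eq hE hac).symm.trans hvs) rfl)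
    · push Not at hex
      have : E = E' := by
        funext u v
        refine propext ⟨fun h => ((hsk u v).1 (.inl h)).resolve_right (hex u v h), fun h => ?_⟩
        refine ((hsk u v).2 (.inl h)).resolve_right fun h' => hex v u h' h
      rw [this]; rfl

/-- **Verma–Pearl.** Two DAGs `G` and `G'` on `Fin p` are Markov equivalent,
i.e. `I(G) = I(G')`, if and only if they have the same skeleton and the same
v-structures. -/
theorem markovEquiv_iff_skeleton_and_vstruct {p : ℕ} (G G' : Fin p → Fin p → Prop)
    (hG : Acyclic G) (hG' : Acyclic G') :
    MarkovEquiv G G' ↔ SameSkeleton G G' ∧ VStruct G = VStruct G' :=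
  ⟨fun h => ⟨h.sameSkeleton hG hG', h.vStruct_eq hG hG'⟩,
    fun h => markovEquiv_of_sameSkeleton_of_vStruct_eq hG hG' h.1 h.2⟩

end CausalDiscovery
end

section
/- Let G and H be DAGs on Fin p with I(H) ⊆ I(G). Then the number of edges of H is at least the number of edges of G, and the two numbers are equal if and only if G and H are Markov equivalent. (In particular, under faithfulness the true DAG and its Markov equivalence class are the sparsest independence maps.) -/
namespace CausalDiscovery

variable {V : Type*}

/-- The number of (directed) edges of a graph. -/
noncomputable def edgeCount {p : ℕ} (E : Fin p → Fin p → Prop) : ℕ :=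
  Nat.card {e : Fin p × Fin p // E e.1 e.2}

/-! ### Active walks -/

/-- The consecutive vertices `a, b, c` of a walk do not block it at `b` given `C`. -/
def ActiveAt (E : V → V → Prop) (C : Finset V) (a b c : V) : Prop :=
  (E a b ∧ E c b → ∃ d ∈ C, Desc E b d) ∧ (¬ (E a b ∧ E c b) → b ∉ C)

/-- `f 0, …, f n` is a walk from `i` to `j` (vertices may repeat) that is not blocked by `C`. -/
structure ActiveWalk (E : V → V → Prop) (C : Finset V) (i j : V) (n : ℕ) (f : ℕ → V) :
    Prop where
  start : f 0 = i
  finish : f n = j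
  adj : ∀ t, t < n → Adj E (f t) (f (t + 1))
  active : ∀ t, t + 1 < n → ActiveAt E C (f t) (f (t + 1)) (f (t + 2))

theorem DConn.activeAt {E : V → V → Prop} {C : Finset V} {n : ℕ} {f : ℕ → V}
    (h : DConn E n f C) (t : ℕ) (ht : t + 1 < n) :
    ActiveAt E C (f t) (f (t + 1)) (f (t + 2)) := by
  obtain ⟨h1, h2⟩ := h (t + 1) (Nat.succ_pos t) ht
  refine ⟨fun hc => ?_, h2⟩
  rcases h1 hc with hm | hm
  · exact ⟨_, hm, .refl⟩
  · exact hm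

theorem dConn_of_activeAt {E : V → V → Prop} {C : Finset V} {n : ℕ} {f : ℕ → V}
    (h : ∀ t, t + 1 < n → ActiveAt E C (f t) (f (t + 1)) (f (t + 2))) : DConn E n f C := by
  rintro (_ | t) h0 ht
  · exact absurd h0 (lt_irrefl 0)
  · exact ⟨fun hc => Or.inr ((h t ht).1 hc), (h t ht).2⟩

theorem ActiveWalk.of_path {E : V → V → Prop} {C : Finset V} {i j : V} {n : ℕ} {f : ℕ → V}
    (hp : IsPath E n f i j) (hc : DConn E n f C) : ActiveWalk E C i j n f :=
  ⟨hp.2.1, hp.2.2.1, hp.2.2.2.2, hc.activeAt⟩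

/-- Removing the vertices at positions `s + 1, …, s + k` from an active walk. -/
theorem ActiveWalk.splice {E : V → V → Prop} {C : Finset V} {i j : V} {n : ℕ} {f : ℕ → V}
    (h : ActiveWalk E C i j n f) (s k : ℕ) (hk : s + k ≤ n)
    (hend : s + k = n → f s = f n)
    (hadj : s + k < n → Adj E (f s) (f (s + k + 1)))
    (hleft : ∀ r, r + 1 = s → s + k < n → ActiveAt E C (f r) (f s) (f (s + k + 1)))
    (hright : s + k + 1 < n → ActiveAt E C (f s) (f (s + k + 1)) (f (s + k + 2))) :
    ActiveWalk E C i j (n - k) (fun u => if u ≤ s then f u else f (u + k)) := by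
  refine ⟨by simp [h.start], ?_, fun u hu => ?_, fun u hu => ?_⟩
  · by_cases hs : n - k ≤ s
    · have : n - k = s := by omega
      simp only [this, le_refl, if_true]
      rw [hend (by omega), h.finish]
    · simp only [hs, if_false]
      rw [Nat.sub_add_cancel (by omega), h.finish]
  · rcases lt_trichotomy u s with hus | rfl | hus
    · simpa [hus.le, Nat.succ_le_of_lt hus] using h.adj u (by omega)
    · simpa [Nat.add_right_comm] using hadj (by omega)
    · have := h.adj (u + k) (by omega)
      simpa [hus.not_ge, (Nat.lt_succ_of_lt hus).not_ge, Nat.add_right_comm] using this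
  · by_cases h1 : u + 2 ≤ s
    · have e1 : u ≤ s := by omega
      have e2 : u + 1 ≤ s := by omega
      simpa only [e1, e2, h1, if_true] using h.active u (by omega)
    by_cases h2 : u + 1 = s
    · have e1 : u ≤ s := by omega
      have := hleft u h2 (by omega)
      simp only [e1, h1, h2, le_refl, if_true, if_false]
      rwa [show u + 2 + k = s + k + 1 by omega]
    by_cases h3 : u = s
    · subst h3
      have e1 : ¬ u + 1 ≤ u := by omega
      simp only [e1, h1, le_refl, if_true, if_false]
      rw [show u + 1 + k = u + k + 1 by omega, show u + 2 + k = u + k + 2 by omega]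
      exact hright (by omega)
    · have e1 : ¬ u ≤ s := by omega
      have e2 : ¬ u + 1 ≤ s := by omega
      simp only [e1, e2, h1, if_false]
      rw [show u + 1 + k = u + k + 1 by omega, show u + 2 + k = u + k + 2 by omega]
      exact h.active (u + k) (by omega)

/-- An active walk leaving a vertex along an outgoing edge either stays directed or shows that
the vertex is a proper ancestor of the conditioning set. -/
theorem ActiveWalk.directed_or_ancestor {E : V → V → Prop} {C : Finset V} {i j : V} {n : ℕ}
    {f : ℕ → V} (h : ActiveWalk E C i j n f) (s : ℕ) (hs : E (f s) (f (s + 1))) (m : ℕ)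
    (hm : s + m + 1 ≤ n) :
    (∃ d ∈ C, Relation.TransGen E (f s) d) ∨
      (E (f (s + m)) (f (s + m + 1)) ∧ Relation.TransGen E (f s) (f (s + m + 1))) := by
  induction m with
  | zero => exact Or.inr ⟨hs, .single hs⟩
  | succ m ih =>
    rcases ih (by omega) with hd | ⟨he, ht⟩
    · exact Or.inl hd
    · rcases h.adj (s + m + 1) (by omega) with h' | h'
      · exact Or.inr ⟨h', ht.tail h'⟩
      · obtain ⟨d, hd, hdesc⟩ := (h.active (s + m) (by omega)).1 ⟨he, h'⟩
        exact Or.inl ⟨d, hd, ht.trans_left hdesc⟩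

/-- A shortest active walk visits no vertex twice. -/
theorem ActiveWalk.injective_of_minimal {E : V → V → Prop} (hE : Acyclic E) {C : Finset V}
    {i j : V} {n : ℕ} {f : ℕ → V} (h : ActiveWalk E C i j n f)
    (hmin : ∀ m g, ActiveWalk E C i j m g → n ≤ m) (s t : ℕ) (hst : s < t) (ht : t ≤ n) :
    f s ≠ f t := by
  intro heq
  obtain ⟨k, rfl⟩ := Nat.exists_eq_add_of_le hst.le
  have key := h.splice s k ht (fun e => by rw [← e]; exact heq)
    (fun hlt => by rw [heq]; exact h.adj _ hlt) ?_
    (fun hlt => by rw [heq]; exact h.active _ hlt)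
  · have := hmin _ _ key
    omega
  · rintro r rfl hlt
    have hA := h.active r (by omega)
    obtain ⟨k, rfl⟩ : ∃ k', k = k' + 1 := ⟨k - 1, by omega⟩
    have hB := h.active (r + 1 + k) (by omega)
    have heq' : f (r + 1 + k + 1) = f (r + 1) := heq.symm
    rw [heq'] at hB
    refine ⟨fun hc => ?_, fun hnc hmem => ?_⟩
    · by_cases hcol : E (f (r + 2)) (f (r + 1))
      · exact hA.1 ⟨hc.1, hcol⟩
      · have hout := (h.adj (r + 1) (by omega)).resolve_right hcol
        rcases h.directed_or_ancestor (r + 1) hout k (by omega) with ⟨d, hd, hdt⟩ | ⟨_, hcyc⟩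
        · exact ⟨d, hd, hdt.to_reflTransGen⟩
        · rw [heq'] at hcyc
          exact absurd hcyc (hE _)
    · have hcA : E (f r) (f (r + 1)) ∧ E (f (r + 2)) (f (r + 1)) :=
        not_not.1 fun hn => hA.2 hn hmem
      have hcB := not_not.1 fun hn => hB.2 hn hmem
      exact hnc ⟨hcA.1, hcB.2⟩

theorem exists_minimal_activeWalk {E : V → V → Prop} {C : Finset V} {i j : V}
    (h : ∃ n f, ActiveWalk E C i j n f) :
    ∃ n f, ActiveWalk E C i j n f ∧ ∀ m g, ActiveWalk E C i j m g → n ≤ m := by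
  classical
  obtain ⟨f, hf⟩ := Nat.find_spec h
  exact ⟨_, f, hf, fun m g hg => Nat.find_min' h ⟨g, hg⟩⟩

theorem dSep_iff_forall_not_activeWalk {E : V → V → Prop} (hE : Acyclic E) {C : Finset V}
    {i j : V} (hij : i ≠ j) : DSep E i j C ↔ ∀ n f, ¬ ActiveWalk E C i j n f := by
  refine ⟨fun h n f hw => ?_, fun h n f hp hc => h n f (.of_path hp hc)⟩
  obtain ⟨n, f, hw, hmin⟩ := exists_minimal_activeWalk ⟨n, f, hw⟩
  have hinj := hw.injective_of_minimal hE hmin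
  refine h n f ⟨?_, hw.start, hw.finish, fun s t hs ht heq => ?_, hw.adj⟩
    (dConn_of_activeAt hw.active)
  · rcases Nat.eq_zero_or_pos n with rfl | hn
    · exact absurd (hw.start.symm.trans hw.finish) hij
    · exact hn
  · rcases lt_trichotomy s t with hlt | rfl | hlt
    · exact absurd heq (hinj s t hlt ht)
    · rfl
    · exact absurd heq.symm (hinj t s hlt hs)

theorem activeAt_congr {E : V → V → Prop} {C : Finset V} {a b c a' c' : V}
    (h : E a b ∧ E c b ↔ E a' b ∧ E c' b) : ActiveAt E C a b c ↔ ActiveAt E C a' b c' := by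
  simp only [ActiveAt, h]

/-- A shortest active walk cannot be shortened by omitting one of its vertices. -/
theorem ActiveWalk.not_shortcut {E : V → V → Prop} {C : Finset V} {i j : V} {n : ℕ} {f : ℕ → V}
    (h : ActiveWalk E C i j n f) (hmin : ∀ m g, ActiveWalk E C i j m g → n ≤ m) (t : ℕ)
    (ht : t + 1 < n) (hadj : Adj E (f t) (f (t + 2)))
    (hleft : ∀ r, r + 1 = t → ActiveAt E C (f r) (f t) (f (t + 1)) →
      ActiveAt E C (f r) (f t) (f (t + 2)))
    (hright : t + 2 < n → ActiveAt E C (f (t + 1)) (f (t + 2)) (f (t + 3)) →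
      ActiveAt E C (f t) (f (t + 2)) (f (t + 3))) : False := by
  have := hmin _ _ (h.splice t 1 ht.le (fun e => absurd e ht.ne) (fun _ => hadj)
    (fun r hr _ => hleft r hr (by subst hr; exact h.active r (by omega)))
    (fun hlt => hright hlt (h.active (t + 1) hlt)))
  omega

/-! ### Reversal of a covered edge -/

/-- `E'` is obtained from `E` by reversing the edge `x → y`, which is covered in `E`: the other
parents of `y` are exactly the parents of `x`. -/
structure CoveredReversal (E E' : V → V → Prop) (x y : V) : Prop where
  edge : E x y
  edge' : E' y x
  not_edge' : ¬ E' x y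
  iff_of_ne : ∀ a b, ¬ (a = x ∧ b = y) → ¬ (a = y ∧ b = x) → (E' a b ↔ E a b)
  parent : ∀ a, E a x → E a y
  parent' : ∀ a, a ≠ x → E a y → E a x

namespace CoveredReversal

variable {E E' : V → V → Prop} {x y : V}

theorem ne (hE : Acyclic E) (h : CoveredReversal E E' x y) : x ≠ y :=
  fun e => hE.irrefl x (by simpa [← e] using h.edge)

theorem symm (hE : Acyclic E) (h : CoveredReversal E E' x y) : CoveredReversal E' E y x where
  edge := h.edge'
  edge' := h.edge
  not_edge' := hE.asymm h.edge
  iff_of_ne a b h1 h2 := (h.iff_of_ne a b h2 h1).symm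
  parent a ha := by
    have hxy := h.ne hE
    have hax : a ≠ x := fun e => h.not_edge' (e ▸ ha)
    have hEay : E a y := (h.iff_of_ne a y (by tauto) (by tauto)).1 ha
    have hEax := h.parent' a hax hEay
    have hay : a ≠ y := fun e => hE.irrefl y (by rw [e] at hEay; exact hEay)
    exact (h.iff_of_ne a x (by tauto) (by tauto)).2 hEax
  parent' a hay ha := by
    have hxy := h.ne hE
    have hEax : E a x := (h.iff_of_ne a x (by tauto) (by tauto)).1 ha
    have hax : a ≠ x := fun e => hE.irrefl x (by rw [e] at hEax; exact hEax)
    exact (h.iff_of_ne a y (by tauto) (by tauto)).2 (h.parent a hEax)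

theorem adj_iff (h : CoveredReversal E E' x y) (a b : V) : Adj E' a b ↔ Adj E a b := by
  by_cases h1 : a = x ∧ b = y
  · obtain ⟨rfl, rfl⟩ := h1
    exact iff_of_true (Or.inr h.edge') (Or.inl h.edge)
  by_cases h2 : a = y ∧ b = x
  · obtain ⟨rfl, rfl⟩ := h2
    exact iff_of_true (Or.inl h.edge') (Or.inr h.edge)
  exact or_congr (h.iff_of_ne a b h1 h2) (h.iff_of_ne b a (by tauto) (by tauto))

theorem transGen (hE : Acyclic E) (h : CoveredReversal E E' x y) {a b : V} (ha : a ≠ y)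
    (hab : Relation.TransGen E' a b) :
    Relation.TransGen E a b ∧ (b = y → Relation.TransGen E a x) := by
  have step : ∀ c, E' c y → E c x := fun c hc =>
    h.parent' c (fun e => h.not_edge' (e ▸ hc)) ((h.iff_of_ne c y
      (fun e => h.not_edge' (e.1 ▸ hc)) (fun e => h.ne hE e.2.symm)).1 hc)
  induction hab with
  | @single b hb =>
    refine ⟨.single ((h.iff_of_ne a b ?_ (by tauto)).1 hb), fun e => .single (step a (e ▸ hb))⟩
    rintro ⟨rfl, rfl⟩
    exact h.not_edge' hb
  | @tail c b _ hcb ih =>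
    refine ⟨?_, fun e => ih.1.tail (step c (e ▸ hcb))⟩
    by_cases hc : c = y ∧ b = x
    · rw [hc.2]
      exact ih.2 hc.1
    · refine ih.1.tail ((h.iff_of_ne c b ?_ hc).1 hcb)
      rintro ⟨rfl, rfl⟩
      exact h.not_edge' hcb

theorem acyclic (hE : Acyclic E) (h : CoveredReversal E E' x y) : Acyclic E' := by
  have key : ∀ v, v ≠ y → ¬ Relation.TransGen E' v v := fun v hv hc =>
    hE v (h.transGen hE hv hc).1
  intro v hc
  by_cases hv : v = y
  · subst hv
    obtain ⟨w, hvw, hwv⟩ := (Relation.TransGen.head'_iff).1 hc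
    refine key w ?_ (.tail' hwv hvw)
    rintro rfl
    have hne := h.ne hE
    exact hE.irrefl w ((h.iff_of_ne w w (by tauto) (by tauto)).1 hvw)
  · exact key v hv hc

theorem desc (hE : Acyclic E) (h : CoveredReversal E E' x y) {v d : V} (hvd : Desc E v d) :
    (v ≠ x → Desc E' v d) ∧ (v = x → Desc E' y d) := by
  have hne := h.ne hE
  have hyx := hE.asymm h.edge
  unfold Desc at *
  induction hvd using Relation.ReflTransGen.head_induction_on with
  | refl => exact ⟨fun _ => .refl, fun e => .single (e ▸ h.edge')⟩
  | @head v w hvw _ ih =>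
    refine ⟨fun hv => ?_, fun hv => ?_⟩
    · by_cases hw : w = x
      · have hvy := h.parent v (hw ▸ hvw)
        exact .head ((h.iff_of_ne v y (by tauto) (by tauto)).2 hvy) (ih.2 hw)
      · exact .head ((h.iff_of_ne v w (by tauto) (by tauto)).2 hvw) (ih.1 hw)
    · subst hv
      have hw : w ≠ v := fun e => hE.irrefl v (by rw [e] at hvw; exact hvw)
      by_cases hwy : w = y
      · exact hwy ▸ ih.1 hw
      · exact .head h.edge' (.head ((h.iff_of_ne v w (by tauto) (by tauto)).2 hvw) (ih.1 hw))

/-- A shortest active walk does not enter `x` from a parent before following `x → y`. -/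
theorem not_parent_before (hE : Acyclic E) (h : CoveredReversal E E' x y) {C : Finset V}
    {i j : V} {n : ℕ} {f : ℕ → V} (hw : ActiveWalk E C i j n f)
    (hmin : ∀ m g, ActiveWalk E C i j m g → n ≤ m) {t : ℕ} (ht : t + 1 < n)
    (h1 : f (t + 1) = x) (h2 : f (t + 2) = y) : ¬ E (f t) x := by
  intro hx
  have hy := h.parent _ hx
  refine hw.not_shortcut hmin t ht (Or.inl (h2 ▸ hy)) (fun r _ => ?_) (fun _ => ?_)
  · rw [h1, h2]
    have := hE.asymm hx
    have := hE.asymm hy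
    exact (activeAt_congr (by tauto)).1
  · rw [h1, h2]
    have := h.edge
    exact (activeAt_congr (by tauto)).1

theorem not_parent_after (hE : Acyclic E) (h : CoveredReversal E E' x y) {C : Finset V}
    {i j : V} {n : ℕ} {f : ℕ → V} (hw : ActiveWalk E C i j n f)
    (hmin : ∀ m g, ActiveWalk E C i j m g → n ≤ m) {t : ℕ} (ht : t + 1 < n)
    (h0 : f t = y) (h1 : f (t + 1) = x) : ¬ E (f (t + 2)) x := by
  intro hx
  have hy := h.parent _ hx
  refine hw.not_shortcut hmin t ht (Or.inr (h0 ▸ hy)) (fun r _ => ?_) (fun _ => ?_)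
  · rw [h0, h1]
    have := h.edge
    exact (activeAt_congr (by tauto)).1
  · rw [h0, h1]
    have := hE.asymm hx
    have := hE.asymm hy
    exact (activeAt_congr (by tauto)).1

/-- A shortest active walk does not enter `y` against an edge into `y` after following
`x → y`. -/
theorem not_collider_after (hE : Acyclic E) (h : CoveredReversal E E' x y) {C : Finset V}
    {i j : V} {n : ℕ} {f : ℕ → V} (hw : ActiveWalk E C i j n f)
    (hmin : ∀ m g, ActiveWalk E C i j m g → n ≤ m) {t : ℕ} (ht : t + 1 < n)
    (h0 : f t = x) (h1 : f (t + 1) = y) : ¬ E (f (t + 2)) y := by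
  intro hy
  have hne : f (t + 2) ≠ x := fun e =>
    hw.injective_of_minimal hE hmin t (t + 2) (by omega) ht (h0.trans e.symm)
  have hx := h.parent' _ hne hy
  refine hw.not_shortcut hmin t ht (Or.inr (h0 ▸ hx)) (fun r hr => ?_) (fun _ => ?_)
  · subst hr
    have hr' := h.not_parent_before hE hw hmin (t := r) (by omega) h0 h1
    rw [h0, h1]
    exact (activeAt_congr (by tauto)).1
  · rw [h0, h1]
    have := hE.asymm hx
    have := hE.asymm hy
    exact (activeAt_congr (by tauto)).1

theorem not_collider_before (hE : Acyclic E) (h : CoveredReversal E E' x y) {C : Finset V}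
    {i j : V} {n : ℕ} {f : ℕ → V} (hw : ActiveWalk E C i j n f)
    (hmin : ∀ m g, ActiveWalk E C i j m g → n ≤ m) {t : ℕ} (ht : t + 1 < n)
    (h1 : f (t + 1) = y) (h2 : f (t + 2) = x) : ¬ E (f t) y := by
  intro hy
  have hne : f t ≠ x := fun e =>
    hw.injective_of_minimal hE hmin t (t + 2) (by omega) ht (e.trans h2.symm)
  have hx := h.parent' _ hne hy
  refine hw.not_shortcut hmin t ht (Or.inl (h2 ▸ hx)) (fun r _ => ?_) (fun hlt => ?_)
  · rw [h1, h2]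
    have := hE.asymm hx
    have := hE.asymm hy
    exact (activeAt_congr (by tauto)).1
  · have := h.not_parent_after hE hw hmin (t := t + 1) hlt h1 h2
    rw [h1, h2]
    exact (activeAt_congr (by tauto)).1

/-- Off the covered edge, replacing `x` by `y` next to a parent of `x` preserves orientation. -/
theorem orient_iff (hE : Acyclic E) (h : CoveredReversal E E' x y) {a b a' b' : V}
    (h1 : ¬ (a = x ∧ b = y)) (h2 : ¬ (a = y ∧ b = x))
    (ha : a' = a ∨ (a = x ∧ a' = y ∧ E b x)) (hb : b' = b ∨ (b = x ∧ b' = y ∧ E a x)) :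
    E' a' b' ↔ E a b := by
  have hxx := hE.irrefl x
  have hpar : ∀ c, E c x → E' c y := fun c hc => by
    refine (h.iff_of_ne c y (fun e => hxx (e.1 ▸ hc)) ?_).2 (h.parent c hc)
    exact fun e => h.ne hE e.2.symm
  rcases ha with rfl | ⟨rfl, rfl, hbx⟩
  · rcases hb with rfl | ⟨rfl, rfl, hax⟩
    · exact h.iff_of_ne _ _ h1 h2
    · exact iff_of_true (hpar _ hax) hax
  · rcases hb with rfl | ⟨rfl, rfl, hax⟩
    · exact iff_of_false ((h.acyclic hE).asymm (hpar _ hbx)) (hE.asymm hbx)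
    · exact absurd hax hxx

theorem exists_activeWalk (hE : Acyclic E) (h : CoveredReversal E E' x y) {C : Finset V}
    {i j : V} (hex : ∃ n f, ActiveWalk E C i j n f) : ∃ n f, ActiveWalk E' C i j n f := by
  classical
  obtain ⟨n, f, hw, hmin⟩ := exists_minimal_activeWalk hex
  have hinj := hw.injective_of_minimal hE hmin
  have hxy := h.ne hE
  have hyx := hE.asymm h.edge
  let P : ℕ → Prop := fun t => 0 < t ∧ t < n ∧ f t = x ∧ E (f (t - 1)) x ∧ E (f (t + 1)) x
  let g : ℕ → V := fun t => if P t then y else f t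
  have g_pos : ∀ t, P t → g t = y := fun t ht => if_pos ht
  have g_neg : ∀ t, ¬ P t → g t = f t := fun t ht => if_neg ht
  have g_next : ∀ t, g t = f t ∨ (f t = x ∧ g t = y ∧ E (f (t + 1)) x) := fun t => by
    by_cases hP : P t
    · exact Or.inr ⟨hP.2.2.1, g_pos t hP, hP.2.2.2.2⟩
    · exact Or.inl (g_neg t hP)
  have g_prev : ∀ t, g (t + 1) = f (t + 1) ∨ (f (t + 1) = x ∧ g (t + 1) = y ∧ E (f t) x) :=
    fun t => by
      by_cases hP : P (t + 1)
      · exact Or.inr ⟨hP.2.2.1, g_pos _ hP, hP.2.2.2.1⟩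
      · exact Or.inl (g_neg _ hP)
  let X : ℕ → Prop := fun t => (f t = x ∧ f (t + 1) = y) ∨ (f t = y ∧ f (t + 1) = x)
  have fwd : ∀ t, ¬ X t → (E' (g t) (g (t + 1)) ↔ E (f t) (f (t + 1))) := fun t hX =>
    h.orient_iff hE (fun e => hX (Or.inl e)) (fun e => hX (Or.inr e)) (g_next t) (g_prev t)
  have bwd : ∀ t, ¬ X t → (E' (g (t + 1)) (g t) ↔ E (f (t + 1)) (f t)) := fun t hX =>
    h.orient_iff hE (fun e => hX (Or.inr e.symm)) (fun e => hX (Or.inl e.symm))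
      (g_prev t) (g_next t)
  refine ⟨n, g, ?_, ?_, fun t ht => ?_, fun t ht => ?_⟩
  · rw [g_neg 0 (fun hP => absurd hP.1 (lt_irrefl 0)), hw.start]
  · rw [g_neg n (fun hP => absurd hP.2.1 (lt_irrefl n)), hw.finish]
  · by_cases hX : X t
    · have h1 : g t = f t := by
        refine g_neg t fun hP => ?_
        rcases hX with e | e
        · exact hyx (e.2 ▸ hP.2.2.2.2)
        · exact hxy (hP.2.2.1.symm.trans e.1)
      have h2 : g (t + 1) = f (t + 1) := by
        refine g_neg _ fun hP => ?_
        rcases hX with e | e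
        · exact hxy (hP.2.2.1.symm.trans e.2)
        · exact hyx (e.1 ▸ hP.2.2.2.1)
      rw [h1, h2]
      exact (h.adj_iff _ _).2 (hw.adj t ht)
    · exact (or_congr (fwd t hX) (bwd t hX)).2 (hw.adj t ht)
  · have hact := hw.active t ht
    have noncollider : ¬ (E (f t) (f (t + 1)) ∧ E (f (t + 2)) (f (t + 1))) →
        ¬ (E' (g t) (g (t + 1)) ∧ E' (g (t + 2)) (g (t + 1))) →
        ActiveAt E' C (g t) (g (t + 1)) (g (t + 2)) := fun hn hn' => by
      refine ⟨fun hc => absurd hc hn', fun _ => ?_⟩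
      rw [g_neg (t + 1) fun hP => hn (by rw [hP.2.2.1]; exact hP.2.2.2)]
      exact hact.2 hn
    have hdist : f t ≠ f (t + 2) := hinj t (t + 2) (by omega) ht
    by_cases hX : X t
    · have hX' : ¬ X (t + 1) := by
        rintro (e | e) <;> rcases hX with e' | e'
        · exact hxy (e.1.symm.trans e'.2)
        · exact hdist (e'.1.trans e.2.symm)
        · exact hdist (e'.1.trans e.2.symm)
        · exact hxy (e'.2.symm.trans e.1)
      have hn : ¬ E (f (t + 2)) (f (t + 1)) := by
        rcases hX with e | e
        · rw [e.2]; exact h.not_collider_after hE hw hmin ht e.1 e.2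
        · rw [e.2]; exact h.not_parent_after hE hw hmin ht e.1 e.2
      exact noncollider (fun hc => hn hc.2) (fun hc => hn ((bwd (t + 1) hX').1 hc.2))
    by_cases hX' : X (t + 1)
    · have hn : ¬ E (f t) (f (t + 1)) := by
        rcases hX' with e | e
        · rw [e.1]; exact h.not_parent_before hE hw hmin ht e.1 e.2
        · rw [e.1]; exact h.not_collider_before hE hw hmin ht e.1 e.2
      exact noncollider (fun hc => hn hc.1) (fun hc => hn ((fwd t hX).1 hc.1))
    by_cases hc : E (f t) (f (t + 1)) ∧ E (f (t + 2)) (f (t + 1))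
    · have hc' : E' (g t) (g (t + 1)) ∧ E' (g (t + 2)) (g (t + 1)) :=
        ⟨(fwd t hX).2 hc.1, (bwd (t + 1) hX').2 hc.2⟩
      refine ⟨fun _ => ?_, fun hn => absurd hc' hn⟩
      obtain ⟨d, hd, hdesc⟩ := hact.1 hc
      by_cases hx : f (t + 1) = x
      · rw [g_pos (t + 1) ⟨t.succ_pos, ht, hx, hx ▸ hc.1, hx ▸ hc.2⟩]
        exact ⟨d, hd, (h.desc hE hdesc).2 hx⟩
      · rw [g_neg (t + 1) fun hP => hx hP.2.2.1]
        exact ⟨d, hd, (h.desc hE hdesc).1 hx⟩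
    · refine noncollider hc fun hc' => hc ⟨(fwd t hX).1 hc'.1, (bwd (t + 1) hX').1 hc'.2⟩

theorem indep_eq (hE : Acyclic E) (h : CoveredReversal E E' x y) : Indep E = Indep E' := by
  ext ⟨i, j, C⟩
  have hE' := h.acyclic hE
  refine and_congr_right fun hij => and_congr_right fun _ => and_congr_right fun _ => ?_
  rw [dSep_iff_forall_not_activeWalk hE hij, dSep_iff_forall_not_activeWalk hE' hij]
  constructor
  · intro hs n f hw
    obtain ⟨m, g, hg⟩ := (h.symm hE).exists_activeWalk hE' ⟨n, f, hw⟩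
    exact hs m g hg
  · intro hs n f hw
    obtain ⟨m, g, hg⟩ := h.exists_activeWalk hE ⟨n, f, hw⟩
    exact hs m g hg

end CoveredReversal

/-- The graph `E` with the edge `x → y` reversed. -/
def reverseEdge (E : V → V → Prop) (x y : V) : V → V → Prop :=
  fun a b => (E a b ∧ ¬ (a = x ∧ b = y)) ∨ (a = y ∧ b = x)

theorem coveredReversal_reverseEdge {E : V → V → Prop} (hE : Acyclic E) {x y : V} (hxy : E x y)
    (hp : ∀ a, E a x → E a y) (hp' : ∀ a, a ≠ x → E a y → E a x) :
    CoveredReversal E (reverseEdge E x y) x y where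
  edge := hxy
  edge' := Or.inr ⟨rfl, rfl⟩
  not_edge' := by
    rintro (h | h)
    · exact h.2 ⟨rfl, rfl⟩
    · exact hE.irrefl x (by simpa [h.2] using hxy)
  iff_of_ne a b h1 h2 := by
    unfold reverseEdge
    tauto
  parent' := hp'
  parent := hp

/-! ### Skeletons and v-structures of independence maps -/

theorem mem_indep_iff {E : V → V → Prop} (hE : Acyclic E) {i j : V} {C : Finset V} :
    (i, j, C) ∈ Indep E ↔
      i ≠ j ∧ i ∉ C ∧ j ∉ C ∧ ∀ n f, ¬ ActiveWalk E C i j n f :=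
  and_congr_right fun hij => and_congr_right fun _ => and_congr_right fun _ =>
    dSep_iff_forall_not_activeWalk hE hij

theorem not_adj_of_mem_indep {E : V → V → Prop} (hE : Acyclic E) {i j : V} {C : Finset V}
    (h : (i, j, C) ∈ Indep E) : ¬ Adj E i j := by
  intro hadj
  refine ((mem_indep_iff hE).1 h).2.2.2 1 (fun t => if t = 0 then i else j)
    ⟨rfl, rfl, fun t ht => ?_, fun t ht => absurd ht (by omega)⟩
  obtain rfl : t = 0 := by omega
  exact hadj

/-- The middle vertex of an unshielded triple is a collider iff it is not in a set separating
the two outer vertices. -/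
theorem collider_iff_notMem {E : V → V → Prop} (hE : Acyclic E) {i j k : V} {C : Finset V}
    (h : (i, k, C) ∈ Indep E) (hij : Adj E i j) (hjk : Adj E j k) :
    E i j ∧ E k j ↔ j ∉ C := by
  have hblock : ¬ ActiveAt E C i j k := fun hact => by
    refine ((mem_indep_iff hE).1 h).2.2.2 2
      (fun t => if t = 0 then i else if t = 1 then j else k)
      ⟨rfl, rfl, fun t ht => ?_, fun t ht => ?_⟩
    · obtain rfl | rfl : t = 0 ∨ t = 1 := by omega
      · exact hij
      · exact hjk
    · obtain rfl : t = 0 := by omega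
      exact hact
  refine ⟨fun hc hj => hblock ⟨fun _ => ⟨j, hj, .refl⟩, fun hn => absurd hc hn⟩, fun hj => ?_⟩
  by_contra hn
  exact hblock ⟨fun hc => absurd hc hn, fun _ => hj⟩

/-- A vertex is separated by its parents from every non-adjacent non-descendant. -/
theorem mem_indep_parents {E : V → V → Prop} (hE : Acyclic E) {i j : V} {C : Finset V}
    (hC : ∀ a, a ∈ C ↔ E a i) (hij : i ≠ j) (hadj : ¬ Adj E i j) (hdesc : ¬ Desc E i j) :
    (i, j, C) ∈ Indep E := by
  refine (mem_indep_iff hE).2 ⟨hij, fun h => hE.irrefl i ((hC i).1 h),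
    fun h => hadj (Or.inr ((hC j).1 h)), fun n f hw => ?_⟩
  rcases n with _ | n
  · exact hij (hw.start.symm.trans hw.finish)
  rcases hw.adj 0 n.succ_pos with h0 | h0
  · rcases hw.directed_or_ancestor 0 h0 n (by omega) with ⟨d, hd, hdt⟩ | ⟨_, ht⟩
    · rw [hw.start] at hdt
      exact hE i (hdt.tail ((hC d).1 hd))
    · rw [Nat.zero_add, hw.finish, hw.start] at ht
      exact hdesc ht.to_reflTransGen
  · rw [hw.start] at h0
    rcases n with _ | n
    · rw [hw.finish] at h0
      exact hadj (Or.inr h0)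
    · refine (hw.active 0 (by omega)).2 (fun hc => ?_) ((hC _).2 h0)
      rw [hw.start] at hc
      exact hE.asymm h0 hc.1

theorem exists_mem_indep_of_not_adj [Finite V] {E : V → V → Prop} (hE : Acyclic E) {i j : V}
    (hij : i ≠ j) (hadj : ¬ Adj E i j) : ∃ C, (i, j, C) ∈ Indep E ∨ (j, i, C) ∈ Indep E := by
  have hfin : ∀ v, ∃ C : Finset V, ∀ a, a ∈ C ↔ E a v := fun v =>
    ⟨(Set.toFinite {a | E a v}).toFinset, fun a => by simp⟩
  by_cases hd : Desc E i j
  · obtain ⟨C, hC⟩ := hfin j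
    refine ⟨C, Or.inr (mem_indep_parents hE hC hij.symm (fun h => hadj h.symm) fun hd' => ?_)⟩
    rcases Relation.reflTransGen_iff_eq_or_transGen.1 hd with e | ht
    · exact hij e.symm
    · exact hE i (ht.trans_left hd')
  · obtain ⟨C, hC⟩ := hfin i
    exact ⟨C, Or.inl (mem_indep_parents hE hC hij hadj hd)⟩

theorem adj_of_imap [Finite V] {G H : V → V → Prop} (hG : Acyclic G) (hH : Acyclic H)
    (himap : Indep H ⊆ Indep G) {i j : V} (h : Adj G i j) : Adj H i j := by
  by_contra hn
  have hij : i ≠ j := by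
    rintro rfl
    exact h.elim (hG.irrefl i) (hG.irrefl i)
  obtain ⟨C, hC | hC⟩ := exists_mem_indep_of_not_adj hH hij hn
  · exact not_adj_of_mem_indep hG (himap hC) h
  · exact not_adj_of_mem_indep hG (himap hC) h.symm

theorem collider_iff_of_imap [Finite V] {G H : V → V → Prop} (hG : Acyclic G) (hH : Acyclic H)
    (himap : Indep H ⊆ Indep G) (hskel : SameSkeleton G H) {a b c : V} (hac : a ≠ c)
    (hn : ¬ Adj G a c) (hab : Adj G a b) (hbc : Adj G b c) :
    G a b ∧ G c b ↔ H a b ∧ H c b := by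
  have hab' := (hskel _ _).1 hab
  have hbc' := (hskel _ _).1 hbc
  obtain ⟨C, hC | hC⟩ := exists_mem_indep_of_not_adj hH hac (fun h => hn ((hskel _ _).2 h))
  · rw [collider_iff_notMem hG (himap hC) hab hbc, collider_iff_notMem hH hC hab' hbc']
  · rw [and_comm, collider_iff_notMem hG (himap hC) hbc.symm hab.symm, and_comm (a := H a b),
      collider_iff_notMem hH hC hbc'.symm hab'.symm]

/-- Chickering's lemma: distinct DAGs with the same skeleton and v-structures differ in an edge
that is covered in the first one. -/
theorem exists_covered_edge [Finite V] {G H : V → V → Prop} (hG : Acyclic G) (hH : Acyclic H)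
    (himap : Indep H ⊆ Indep G) (hskel : SameSkeleton G H) (hne : ∃ x y, G x y ∧ H y x) :
    ∃ x y, G x y ∧ H y x ∧ (∀ a, G a x → G a y) ∧ (∀ a, a ≠ x → G a y → G a x) := by
  have : Std.Irrefl (Relation.TransGen G) := ⟨hG⟩
  have : Std.Irrefl (Function.swap (Relation.TransGen G)) := ⟨hG⟩
  have wf : WellFounded (Relation.TransGen G) := Finite.wellFounded_of_trans_of_irrefl _
  have wf' : WellFounded (Function.swap (Relation.TransGen G)) :=
    Finite.wellFounded_of_trans_of_irrefl _
  obtain ⟨y, ⟨x₀, hx₀⟩, hymin⟩ := wf.has_min {y | ∃ x, G x y ∧ H y x}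
    (by obtain ⟨x, y, h⟩ := hne; exact ⟨y, x, h⟩)
  obtain ⟨x, ⟨hxy, hyx⟩, hxmax⟩ := wf'.has_min {x | G x y ∧ H y x} ⟨x₀, hx₀⟩
  have keep : ∀ a b, G a b → Relation.TransGen G b y → H a b := fun a b hab hby =>
    ((hskel a b).1 (Or.inl hab)).resolve_right fun hba => hymin b ⟨a, hab, hba⟩ hby
  refine ⟨x, y, hxy, hyx, fun a ha => ?_, fun a hax ha => ?_⟩
  · have hay : a ≠ y := fun e => hG.asymm hxy (e ▸ ha)
    have hadj : Adj G a y := by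
      by_contra hn
      have hHax := keep a x ha (.single hxy)
      exact hG.asymm hxy ((collider_iff_of_imap hG hH himap hskel hay hn (Or.inl ha)
        (Or.inl hxy)).2 ⟨hHax, hyx⟩).2
    refine hadj.resolve_right fun hya => ?_
    exact hG a (((Relation.TransGen.single ha).tail hxy).tail hya)
  · have hadj : Adj G a x := by
      by_contra hn
      exact hH.asymm hyx ((collider_iff_of_imap hG hH himap hskel hax hn (Or.inl ha)
        (Or.inr hxy)).1 ⟨ha, hxy⟩).2
    refine hadj.resolve_right fun hxa => ?_
    have hHxa := keep x a hxa (.single ha)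
    have hHay : H a y := ((hskel a y).1 (Or.inl ha)).resolve_right fun hya =>
      hxmax a ⟨ha, hya⟩ (.single hxa)
    exact hH x (((Relation.TransGen.single hHxa).tail hHay).tail hyx)

/-- An independence map with the same skeleton is Markov equivalent. -/
theorem indep_eq_of_imap_of_sameSkeleton [Finite V] {G H : V → V → Prop} (hG : Acyclic G)
    (hH : Acyclic H) (himap : Indep H ⊆ Indep G) (hskel : SameSkeleton G H) :
    Indep G = Indep H := by
  induction hm : {e : V × V | G e.1 e.2 ∧ H e.2 e.1}.ncard using Nat.strong_induction_on
    generalizing G with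
  | _ m ih =>
  subst hm
  by_cases hne : ∃ x y, G x y ∧ H y x
  · obtain ⟨x, y, hxy, hyx, hp, hp'⟩ := exists_covered_edge hG hH himap hskel hne
    have hcov := coveredReversal_reverseEdge hG hxy hp hp'
    have heq := hcov.indep_eq hG
    rw [heq]
    refine ih _ (Set.ncard_lt_ncard ?_ (Set.toFinite _)) (hcov.acyclic hG) (heq ▸ himap)
      (fun a b => (hcov.adj_iff a b).trans (hskel a b)) rfl
    refine Set.ssubset_iff_of_subset ?_ |>.2
      ⟨(x, y), ⟨hxy, hyx⟩, fun h => hcov.not_edge' h.1⟩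
    rintro ⟨a, b⟩ ⟨h | ⟨rfl, rfl⟩, hba⟩
    · exact ⟨h.1, hba⟩
    · exact absurd hba (hH.asymm hyx)
  · have hGH : ∀ a b, G a b → H a b := fun a b hab =>
      ((hskel a b).1 (Or.inl hab)).resolve_right fun hba => hne ⟨a, b, hab, hba⟩
    have : G = H := by
      funext a b
      refine propext ⟨hGH a b, fun hab => ?_⟩
      exact ((hskel a b).2 (Or.inl hab)).resolve_right fun hba => hH.asymm hab (hGH b a hba)
    rw [this]

/-! ### Counting edges -/

theorem edgeCount_le_and_sameSkeleton_of_eq {p : ℕ} {G H : Fin p → Fin p → Prop}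
    (hG : Acyclic G) (hadj : ∀ i j, Adj G i j → Adj H i j) :
    edgeCount G ≤ edgeCount H ∧ (edgeCount G = edgeCount H → SameSkeleton G H) := by
  classical
  let φ : {e : Fin p × Fin p // G e.1 e.2} → {e : Fin p × Fin p // H e.1 e.2} := fun e =>
    if h : H e.1.1 e.1.2 then ⟨e.1, h⟩
    else ⟨e.1.swap, (hadj _ _ (Or.inl e.2)).resolve_left h⟩
  have hφ : ∀ e, (φ e).1 = e.1 ∨ (φ e).1 = e.1.swap := fun e => by
    by_cases h : H e.1.1 e.1.2
    · exact Or.inl (by simp [φ, h])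
    · exact Or.inr (by simp [φ, h])
  have hinj : Function.Injective φ := by
    rintro ⟨⟨a, b⟩, hab⟩ ⟨⟨c, d⟩, hcd⟩ heq
    have h1 := hφ ⟨⟨a, b⟩, hab⟩
    have h2 := hφ ⟨⟨c, d⟩, hcd⟩
    rw [heq] at h1
    have := hG.asymm hab
    rcases h1 with h1 | h1 <;> rcases h2 with h2 | h2 <;>
      simp only [h2, Prod.swap_prod_mk, Prod.mk.injEq] at h1 <;>
      obtain ⟨rfl, rfl⟩ := h1
    · rfl
    · exact absurd hcd this
    · exact absurd hcd this
    · rfl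
  refine ⟨Nat.card_le_card_of_injective φ hinj, fun hcard i j => ⟨hadj i j, ?_⟩⟩
  have hsurj : Function.Surjective φ :=
    ((Nat.bijective_iff_injective_and_card φ).2 ⟨hinj, hcard⟩).2
  have hback : ∀ i j, H i j → Adj G i j := fun i j hij => by
    obtain ⟨⟨⟨a, b⟩, hab⟩, he⟩ := hsurj ⟨(i, j), hij⟩
    have h1 := hφ ⟨⟨a, b⟩, hab⟩
    rw [he] at h1
    rcases h1 with h1 | h1 <;> simp only [Prod.swap_prod_mk, Prod.mk.injEq] at h1 <;>
      obtain ⟨rfl, rfl⟩ := h1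
    · exact Or.inl hab
    · exact Or.inr hab
  rintro (h | h)
  · exact hback i j h
  · exact (hback j i h).symm

/-- If `G` and `H` are DAGs on `Fin p` with `I(H) ⊆ I(G)`, then the number of edges
of `H` is at least the number of edges of `G`, with equality if and only if `G` and
`H` are Markov equivalent. -/
theorem edgeCount_le_of_imap {p : ℕ} (G H : Fin p → Fin p → Prop)
    (hG : Acyclic G) (hH : Acyclic H) (himap : Indep H ⊆ Indep G) :
    edgeCount G ≤ edgeCount H ∧ (edgeCount G = edgeCount H ↔ MarkovEquiv G H) := by
  obtain ⟨hle, hskel⟩ := edgeCount_le_and_sameSkeleton_of_eq (H := H) hG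
    fun _ _ => adj_of_imap hG hH himap
  refine ⟨hle, fun heq => indep_eq_of_imap_of_sameSkeleton hG hH himap (hskel heq), fun hM => ?_⟩
  exact hle.antisymm (edgeCount_le_and_sameSkeleton_of_eq (H := G) hH
    fun _ _ => adj_of_imap hH hG hM.subset).1

end CausalDiscovery
end
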